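/- arXiv:2408.09981 — 2 statements merged into one kernel-verified Lean document; each statement's English description precedes it below -/
import Mathlib

section
/- Let d, N, M be positive integers with M ≥ N and let H : ℤ^d → ℝ^{M×N} be a matrix-valued filter with absolutely summable entries. Then the convolution operator T_H : ℓ₂^N(ℤ^d) → ℓ₂^M(ℤ^d), x ↦ H ∗ x, is an isometry (‖H ∗ x‖ = ‖x‖ for all x ∈ ℓ₂^N(ℤ^d)) if and only if the filter is invertible by flip-transposition, i.e. (H^{T∨} ∗ H)[k] = ∑_{m∈ℤ^d} H[m]ᵀ H[m+k] = δ[k] I_N for all k ∈ ℤ^d, where H^{T∨}[k] = H[−k]ᵀ. -/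
open Matrix

lemma aux_shift_exists {G E F : Type*} [AddCommGroup G] [NormedAddCommGroup E] [NormedSpace ℝ E]
    [NormedAddCommGroup F] [NormedSpace ℝ F] (A : E →L[ℝ] F) (m : G) :
    ∃ S : lp (fun _ : G => E) 2 →L[ℝ] lp (fun _ : G => F) 2,
      ‖S‖ ≤ ‖A‖ ∧ ∀ x k, S x k = A (x (k - m)) := by
  have h2 : (0 : ℝ) < (2 : ENNReal).toReal := by norm_num
  have hs : ∀ x : lp (fun _ : G => E) 2,
      HasSum (fun k => ‖A‖ ^ 2 * ‖x (k - m)‖ ^ 2) (‖A‖ ^ 2 * ‖x‖ ^ 2) := by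
    intro x
    have h := lp.hasSum_norm h2 x
    have h' := (Equiv.subRight m).hasSum_iff.mpr h
    simpa [Function.comp_def] using h'.mul_left (‖A‖ ^ 2)
  have hle : ∀ (x : lp (fun _ : G => E) 2) k,
      ‖A (x (k - m))‖ ^ 2 ≤ ‖A‖ ^ 2 * ‖x (k - m)‖ ^ 2 := by
    intro x k
    rw [← mul_pow]
    exact pow_le_pow_left₀ (norm_nonneg _) (A.le_opNorm _) 2
  have hmem : ∀ x : lp (fun _ : G => E) 2, Memℓp (fun k => A (x (k - m))) 2 := by
    intro x
    apply memℓp_gen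
    have := Summable.of_nonneg_of_le (fun k => by positivity) (hle x) (hs x).summable
    simpa using this
  let L : lp (fun _ : G => E) 2 →ₗ[ℝ] lp (fun _ : G => F) 2 :=
    { toFun := fun x => ⟨fun k => A (x (k - m)), hmem x⟩
      map_add' := by
        intro x y
        apply lp.ext
        funext k
        exact map_add A _ _
      map_smul' := by
        intro c x
        apply lp.ext
        funext k
        exact map_smul A _ _ }
  have hL : ∀ x, ‖L x‖ ≤ ‖A‖ * ‖x‖ := by
    intro x
    apply lp.norm_le_of_forall_sum_le h2 (by positivity)
    intro s
    have h1 := sum_le_hasSum s (fun k _ => by positivity) (hs x)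
    have h3 := Finset.sum_le_sum (s := s) (fun k _ => hle x k)
    have := h3.trans h1
    rw [← mul_pow] at this
    simpa [L] using this
  refine ⟨L.mkContinuous ‖A‖ hL, L.mkContinuous_norm_le (norm_nonneg _) hL, fun x k => rfl⟩

lemma aux_conv_exists {G : Type*} [AddCommGroup G] {N M : ℕ}
    (H : G → Matrix (Fin M) (Fin N) ℝ)
    (hsum : ∀ (i : Fin M) (n : Fin N), Summable fun k : G => |H k i n|) :
    ∃ T : lp (fun _ : G => EuclideanSpace ℝ (Fin N)) 2 →L[ℝ]
        lp (fun _ : G => EuclideanSpace ℝ (Fin M)) 2,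
      ∀ x k i, T x k i = ∑' m : G, ∑ n : Fin N, H m i n * x (k - m) n := by
  let Φ : Matrix (Fin M) (Fin N) ℝ →ₗ[ℝ]
      (EuclideanSpace ℝ (Fin N) →L[ℝ] EuclideanSpace ℝ (Fin M)) :=
    (LinearMap.toContinuousLinearMap.toLinearMap).comp (Matrix.toEuclideanLin).toLinearMap
  have hΦ : ∀ A v i, Φ A v i = ∑ n, A i n * v n := by
    intro A v i
    rfl
  have hH : Summable H := by
    refine Pi.summable.mpr fun i => Pi.summable.mpr fun n => ?_
    exact (hsum i n).of_abs
  have hA : Summable fun m => ‖Φ (H m)‖ :=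
    summable_norm_iff.mpr (hH.map Φ Φ.continuous_of_finiteDimensional)
  choose S hS1 hS2 using fun m => aux_shift_exists (Φ (H m)) m
  have hSs : Summable S :=
    (Summable.of_nonneg_of_le (fun m => norm_nonneg _) hS1 hA).of_norm
  refine ⟨∑' m, S m, fun x k i => ?_⟩
  let ev : (lp (fun _ : G => EuclideanSpace ℝ (Fin N)) 2 →L[ℝ]
        lp (fun _ : G => EuclideanSpace ℝ (Fin M)) 2) →L[ℝ] ℝ :=
    ((EuclideanSpace.proj i).comp (lp.evalCLM ℝ (fun _ : G => EuclideanSpace ℝ (Fin M)) 2 k)).comp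
      (ContinuousLinearMap.apply ℝ _ x)
  have h := ev.map_tsum hSs
  calc _ = ev (∑' m, S m) := rfl
    _ = _ := h
    _ = _ := by
      congr 1
      funext m
      change (S m x k) i = _
      rw [hS2, hΦ]

open Classical in
lemma aux_inner {G : Type*} [AddCommGroup G] {N M : ℕ}
    (H : G → Matrix (Fin M) (Fin N) ℝ)
    (T : lp (fun _ : G => EuclideanSpace ℝ (Fin N)) 2 →L[ℝ]
        lp (fun _ : G => EuclideanSpace ℝ (Fin M)) 2)
    (hT : ∀ x k i, T x k i = ∑' m : G, ∑ n : Fin N, H m i n * x (k - m) n)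
    (a b : G) (n n' : Fin N) :
    inner ℝ (T (lp.single 2 a (EuclideanSpace.single n 1)))
      (T (lp.single 2 b (EuclideanSpace.single n' 1))) =
    ∑' m, ((H m)ᵀ * H (m + (a - b))) n n' := by
  have hTe : ∀ a n k i, T (lp.single 2 a (EuclideanSpace.single n 1)) k i = H (k - a) i n := by
    intro a n k i
    rw [hT, tsum_eq_single (k - a)]
    · rw [sub_sub_cancel, lp.single_apply_self]
      simp
    · intro m hm
      rw [lp.single_apply_ne]
      · simp
      · rintro rfl
        simp at hm
  rw [lp.inner_eq_tsum, ← (Equiv.subRight a).tsum_eq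
    (fun m => ((H m)ᵀ * H (m + (a - b))) n n')]
  congr 1
  funext k
  simp only [PiLp.inner_apply, hTe, Matrix.mul_apply, Matrix.transpose_apply, Equiv.subRight_apply]
  refine Finset.sum_congr rfl fun i _ => ?_
  rw [sub_add_sub_cancel]
  exact mul_comm _ _

open Classical in
lemma aux_inner_single {G : Type*} {N : ℕ}
    (a b : G) (n n' : Fin N) :
    inner ℝ (lp.single 2 a (EuclideanSpace.single n 1) :
        lp (fun _ : G => EuclideanSpace ℝ (Fin N)) 2)
      (lp.single 2 b (EuclideanSpace.single n' 1)) =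
    if a = b then (1 : Matrix (Fin N) (Fin N) ℝ) n n' else 0 := by
  rw [lp.inner_single_left]
  split_ifs with h
  · subst h
    rw [lp.single_apply_self]
    refine (EuclideanSpace.inner_single_left n (1 : ℝ) (EuclideanSpace.single n' 1)).trans ?_
    simp [Matrix.one_apply, Pi.single_apply]
  · rw [lp.single_apply_ne _ _ _ h]
    simp

/-- Let `M ≥ N` and let `H : ℤ^d → ℝ^{M×N}` be a matrix-valued filter
with absolutely summable entries. Then the convolution operator
`T_H : ℓ₂^N(ℤ^d) → ℓ₂^M(ℤ^d)`, `x ↦ H ∗ x`, is an isometry if and only if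
`(H^{T∨} ∗ H)[k] = ∑_m H[m]ᵀ H[m+k] = δ[k] I_N` for all `k ∈ ℤ^d`. -/
theorem conv_isometry_iff_flip_transpose_inverse
    (d N M : ℕ) (hd : 0 < d) (hN : 0 < N) (hM : 0 < M) (hMN : N ≤ M)
    (H : (Fin d → ℤ) → Matrix (Fin M) (Fin N) ℝ)
    (hsum : ∀ (i : Fin M) (n : Fin N), Summable fun k : Fin d → ℤ => |H k i n|) :
    (∀ x : lp (fun _ : Fin d → ℤ => EuclideanSpace ℝ (Fin N)) 2,
      ∃ u : lp (fun _ : Fin d → ℤ => EuclideanSpace ℝ (Fin M)) 2,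
        (∀ (k : Fin d → ℤ) (i : Fin M),
          u k i = ∑' m : Fin d → ℤ, ∑ n : Fin N, H m i n * x (k - m) n) ∧
        ‖u‖ = ‖x‖) ↔
    (∀ (k : Fin d → ℤ) (n n' : Fin N),
      ∑' m : Fin d → ℤ, ((H m)ᵀ * H (m + k)) n n' =
        if k = 0 then (1 : Matrix (Fin N) (Fin N) ℝ) n n' else 0) := by

  classical
  obtain ⟨T, hT⟩ := aux_conv_exists H hsum
  have hI := aux_inner H T hT
  constructor
  · intro h
    have hn : ∀ x, ‖T x‖ = ‖x‖ := by
      intro x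
      obtain ⟨u, hu, hux⟩ := h x
      have : T x = u := by
        apply lp.ext
        funext k
        ext i
        rw [hT, hu]
      rw [this, hux]
    let L : lp (fun _ : Fin d → ℤ => EuclideanSpace ℝ (Fin N)) 2 →ₗᵢ[ℝ]
        lp (fun _ : Fin d → ℤ => EuclideanSpace ℝ (Fin M)) 2 := ⟨T.toLinearMap, hn⟩
    intro k n n'
    have h1 := hI k 0 n n'
    rw [sub_zero] at h1
    rw [← h1]
    have h2 := (L.inner_map_map (lp.single 2 k (EuclideanSpace.single n 1))
      (lp.single 2 0 (EuclideanSpace.single n' 1))).trans (by convert aux_inner_single k 0 n n')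
    have hL : ∀ y, L y = T y := fun _ => rfl
    rw [hL, hL] at h2
    convert h2
  · intro h x
    refine ⟨T x, hT x, ?_⟩
    have hTT : (ContinuousLinearMap.adjoint T).comp T = ContinuousLinearMap.id ℝ _ := by
      refine lp.ext_continuousLinearMap (ENNReal.ofNat_ne_top (n := 2)) fun b => ?_
      apply ContinuousLinearMap.coe_injective
      refine (EuclideanSpace.basisFun (Fin N) ℝ).toBasis.ext fun n' => ?_
      apply lp.ext
      funext a
      ext n
      have key : ∀ y : lp (fun _ : Fin d → ℤ => EuclideanSpace ℝ (Fin N)) 2,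
          y a n = inner ℝ (lp.single 2 a (EuclideanSpace.single n 1)) y := by
        intro y
        rw [lp.inner_single_left]
        refine Eq.trans ?_ (EuclideanSpace.inner_single_left n (1 : ℝ) (y a)).symm
        simp
      rw [key, key]
      simp only [ContinuousLinearMap.coe_coe, ContinuousLinearMap.comp_apply,
        OrthonormalBasis.coe_toBasis, EuclideanSpace.basisFun_apply,
        lp.singleContinuousLinearMap_apply, ContinuousLinearMap.adjoint_inner_right,
        ContinuousLinearMap.id_apply]
      have h1 := hI a b n n'
      have h2 := aux_inner_single a b n n'
      rw [h] at h1
      simp only [sub_eq_zero] at h1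
      convert h1.trans (Eq.trans (by congr) h2.symm)
    have h3 : inner ℝ (T x) (T x) = inner ℝ x x := by
      rw [← ContinuousLinearMap.adjoint_inner_right, ← ContinuousLinearMap.comp_apply, hTT]
      rfl
    rw [real_inner_self_eq_norm_sq, real_inner_self_eq_norm_sq] at h3
    exact (sq_eq_sq₀ (norm_nonneg _) (norm_nonneg _)).mp h3
end

section
/- Let d, N, M be positive integers with M ≥ N and let H : ℤ^d → ℝ^{M×N} be a matrix-valued filter with absolutely summable entries, with frequency response Ĥ(ω) = ∑_{k∈ℤ^d} H[k] e^{−i⟨ω,k⟩} ∈ ℂ^{M×N}. Then the convolution operator T_H : ℓ₂^N(ℤ^d) → ℓ₂^M(ℤ^d), x ↦ H ∗ x, is an isometry (‖H ∗ x‖ = ‖x‖ for all x ∈ ℓ₂^N(ℤ^d)) if and only if Ĥ is paraunitary, i.e. Ĥ(ω)^H Ĥ(ω) = I_N for every ω ∈ ℝ^d, where Ĥ(ω)^H denotes the conjugate transpose. -/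
open Matrix

noncomputable section ConvAux

open UnitAddTorus MeasureTheory in
lemma cia_unique_aux {d : ℕ} {m : MeasurableSpace (UnitAddTorus (Fin d))}
    {_ : BorelSpace (UnitAddTorus (Fin d))} (μ : Measure (UnitAddTorus (Fin d)))
    {_ : IsFiniteMeasure μ}
    (ho : Orthonormal ℂ (fun n : Fin d → ℤ => ContinuousMap.toLp (E := ℂ) 2 μ ℂ (mFourier n)))
    (a : (Fin d → ℤ) → ℂ) (z : ℂ)
    (hF : HasSum (fun p : Fin d → ℤ => a p • (mFourier p : C(UnitAddTorus (Fin d), ℂ)))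
      (z • mFourier 0)) (p : Fin d → ℤ) : a p = if p = 0 then z else 0 := by
  have h4 := hF.mapL ((innerSL ℂ (ContinuousMap.toLp (E := ℂ) 2 μ ℂ (mFourier p))).comp
    (ContinuousMap.toLp (E := ℂ) 2 μ ℂ))
  have h5 := orthonormal_iff_ite.mp ho
  simp only [map_smul, ContinuousLinearMap.comp_apply, innerSL_apply_apply, h5, smul_eq_mul,
    mul_ite, mul_one, mul_zero] at h4
  have h6 := hasSum_ite_eq p (a p)
  refine h6.unique ?_
  refine h4.congr_fun fun q => ?_
  by_cases hq : p = q
  · subst hq; simp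
  · simp [hq, Ne.symm hq]

open UnitAddTorus MeasureTheory in
lemma cia_unique {d : ℕ} (a : (Fin d → ℤ) → ℂ) (ha : Summable fun p => ‖a p‖) (z : ℂ)
    (h : ∀ ω : Fin d → ℝ, HasSum (fun p : Fin d → ℤ =>
      a p * Complex.exp (-Complex.I * ((∑ j, ω j * (p j : ℝ) : ℝ) : ℂ))) z)
    (p : Fin d → ℤ) : a p = if p = 0 then z else 0 := by
  have hs : Summable (fun p : Fin d → ℤ => a p • (mFourier p : C(UnitAddTorus (Fin d), ℂ))) := by
    apply Summable.of_norm
    simpa only [norm_smul, mFourier_norm, mul_one] using ha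
  have hF : HasSum (fun p : Fin d → ℤ => a p • (mFourier p : C(UnitAddTorus (Fin d), ℂ)))
      (z • mFourier 0) := by
    convert hs.hasSum using 1
    ext x
    obtain ⟨y, rfl⟩ : ∃ y : Fin d → ℝ, x = fun j => (y j : UnitAddCircle) := by
      choose y hy using fun j => QuotientAddGroup.mk_surjective (x j)
      exact ⟨y, funext fun j => (hy j).symm⟩
    have h1 := (ContinuousMap.hasSum_apply hs.hasSum (fun j => (y j : UnitAddCircle)))
    refine HasSum.unique ?_ h1
    have h2 := h (fun j => - (2 * Real.pi * y j))
    rw [mFourier_zero]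
    simp only [ContinuousMap.smul_apply, ContinuousMap.one_apply, smul_eq_mul, mul_one]
    convert h2 using 3 with q
    simp only [mFourier, ContinuousMap.coe_mk, fourier_coe_apply]
    rw [← Complex.exp_sum]
    congr 1
    push_cast
    rw [Finset.mul_sum]
    refine Finset.sum_congr rfl fun j _ => ?_
    ring
  exact cia_unique_aux _ orthonormal_mFourier a z hF p

lemma cia_corr {d : ℕ} (a b : (Fin d → ℤ) → ℝ) (ha : Summable fun k => |a k|)
    (hb : Summable fun k => |b k|) :
    (∀ p, Summable fun k => a k * b (k + p)) ∧
    (Summable fun p => ‖((∑' k, a k * b (k + p) : ℝ) : ℂ)‖) ∧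
    ∀ ω : Fin d → ℝ, HasSum (fun p : Fin d → ℤ => ((∑' k, a k * b (k + p) : ℝ) : ℂ) *
        Complex.exp (-Complex.I * ((∑ j, ω j * (p j : ℝ) : ℝ) : ℂ)))
      (star (∑' k : Fin d → ℤ, (a k : ℂ) *
          Complex.exp (-Complex.I * ((∑ j, ω j * (k j : ℝ) : ℝ) : ℂ))) *
        ∑' k : Fin d → ℤ, (b k : ℂ) *
          Complex.exp (-Complex.I * ((∑ j, ω j * (k j : ℝ) : ℝ) : ℂ))) := by
  let e : ((Fin d → ℤ) × (Fin d → ℤ)) ≃ ((Fin d → ℤ) × (Fin d → ℤ)) :=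
    { toFun := fun x => (x.2, x.2 + x.1)
      invFun := fun x => (x.2 - x.1, x.1)
      left_inv := fun x => by simp
      right_inv := fun x => by simp }
  have hprod : Summable fun x : (Fin d → ℤ) × (Fin d → ℤ) => |a x.1| * |b x.2| :=
    ha.mul_of_nonneg hb (fun _ => abs_nonneg _) (fun _ => abs_nonneg _)
  have h1 : Summable fun x : (Fin d → ℤ) × (Fin d → ℤ) => |a x.2 * b (x.2 + x.1)| := by
    have := e.summable_iff.mpr hprod
    simpa only [Function.comp_def, e, Equiv.coe_fn_mk, abs_mul] using this
  have h2 : ∀ p, Summable fun k => |a k * b (k + p)| := fun p => h1.prod_factor p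
  have hE : ∀ (ω : Fin d → ℝ) (k : Fin d → ℤ),
      ‖Complex.exp (-Complex.I * ((∑ j, ω j * (k j : ℝ) : ℝ) : ℂ))‖ = 1 := by
    intro ω k
    rw [neg_mul, mul_comm, ← neg_mul, ← Complex.ofReal_neg]
    exact Complex.norm_exp_ofReal_mul_I _
  refine ⟨fun p => (h2 p).of_abs, ?_, fun ω => ?_⟩
  · refine Summable.of_nonneg_of_le (fun _ => norm_nonneg _) (fun p => ?_) h1.prod
    rw [Complex.norm_real]
    exact norm_tsum_le_tsum_norm (h2 p)
  · set E : (Fin d → ℤ) → ℂ := fun k =>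
      Complex.exp (-Complex.I * ((∑ j, ω j * (k j : ℝ) : ℝ) : ℂ)) with hEdef
    have hstar : ∀ k p, star (E k) * E (k + p) = E p := by
      intro k p
      simp only [hEdef]
      rw [Complex.star_def, ← Complex.exp_conj, ← Complex.exp_add]
      congr 1
      simp only [map_mul, map_neg, Complex.conj_I, Complex.conj_ofReal, Pi.add_apply]
      push_cast
      simp only [mul_add, Finset.sum_add_distrib]
      ring
    have hE' : ∀ k, ‖E k‖ = 1 := hE ω
    have hA : Summable fun k => ‖star ((a k : ℂ) * E k)‖ := by
      simpa only [norm_star, norm_mul, hE', mul_one, Complex.norm_real, Real.norm_eq_abs] using ha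
    have hB : Summable fun k => ‖(b k : ℂ) * E k‖ := by
      simpa only [norm_mul, hE', mul_one, Complex.norm_real, Real.norm_eq_abs] using hb
    have hS : Summable fun x : (Fin d → ℤ) × (Fin d → ℤ) =>
        star ((a x.1 : ℂ) * E x.1) * ((b x.2 : ℂ) * E x.2) :=
      summable_mul_of_summable_norm (f := fun k => star ((a k : ℂ) * E k))
        (g := fun k => (b k : ℂ) * E k) hA hB
    have hAB := HasSum.mul hA.of_norm.hasSum hB.of_norm.hasSum hS
    have h3 := e.hasSum_iff.mpr hAB
    rw [← tsum_star] at h3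
    refine HasSum.prod_fiberwise h3 (fun p => ?_)
    have h4 := (((h2 p).of_abs.hasSum).mapL Complex.ofRealCLM).mul_right (E p)
    simp only [Complex.ofRealCLM_apply] at h4
    refine h4.congr_fun fun k => ?_
    simp only [Function.comp_def, e, Equiv.coe_fn_mk, ← hstar k p, star_mul', Complex.star_def,
      Complex.conj_ofReal]
    push_cast
    ring

section
variable {d N M : ℕ} (H : (Fin d → ℤ) → Matrix (Fin M) (Fin N) ℝ)
    (hsum : ∀ (i : Fin M) (n : Fin N), Summable fun k : Fin d → ℤ => |H k i n|)

def ciaV (q : Fin d → ℤ) (n : Fin N) : lp (fun _ : Fin d → ℤ => EuclideanSpace ℝ (Fin M)) 2 :=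
  ⟨fun k => WithLp.toLp 2 (fun i => H (k - q) i n), by
    refine Memℓp.of_exponent_ge (q := 1) (memℓp_gen ?_) (by norm_num)
    have h : Summable fun k : Fin d → ℤ => ∑ i, |H (k - q) i n| :=
      summable_sum fun i _ => (Equiv.subRight q).summable_iff.mpr (hsum i n)
    refine Summable.of_nonneg_of_le (fun _ => by positivity) (fun k => ?_) h
    simp only [ENNReal.toReal_one, Real.rpow_one]
    rw [EuclideanSpace.norm_eq]
    apply Real.sqrt_le_iff.mpr
    refine ⟨Finset.sum_nonneg fun _ _ => abs_nonneg _, ?_⟩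
    exact Finset.sum_sq_le_sq_sum_of_nonneg fun _ _ => abs_nonneg _⟩

lemma ciaV_apply (q : Fin d → ℤ) (n : Fin N) (k : Fin d → ℤ) (i : Fin M) :
    ciaV H hsum q n k i = H (k - q) i n := rfl

lemma ciaV_inner (q q' : Fin d → ℤ) (n n' : Fin N) :
    inner ℝ (ciaV H hsum q n) (ciaV H hsum q' n') =
      ∑ i, ∑' k, H k i n * H (k + (q - q')) i n' := by
  rw [lp.inner_eq_tsum, ← (Equiv.addRight q).tsum_eq, ← Summable.tsum_finsetSum]
  · refine tsum_congr fun k => ?_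
    rw [PiLp.inner_apply]
    refine Finset.sum_congr rfl fun i _ => ?_
    rw [ciaV_apply, ciaV_apply]
    simp [mul_comm, add_sub_assoc]
  · intro i _
    exact (cia_corr _ _ (hsum i n) (hsum i n')).1 _

def ciaL (q : Fin d → ℤ) :
    EuclideanSpace ℝ (Fin N) →ₗ[ℝ] lp (fun _ : Fin d → ℤ => EuclideanSpace ℝ (Fin M)) 2 where
  toFun w := ∑ n, w n • ciaV H hsum q n
  map_add' w w' := by simp [add_smul, Finset.sum_add_distrib]
  map_smul' c w := by simp [mul_smul, Finset.smul_sum]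

def ciaEval (k : Fin d → ℤ) (i : Fin M) :
    lp (fun _ : Fin d → ℤ => EuclideanSpace ℝ (Fin M)) 2 →L[ℝ] ℝ :=
  LinearMap.mkContinuous
    { toFun := fun u => u k i
      map_add' := fun u v => by simp
      map_smul' := fun c u => by simp } 1 (fun u => by
        rw [one_mul]
        exact (PiLp.norm_apply_le (u k) i).trans (lp.norm_apply_le_norm (by norm_num) u k))

lemma ciaEval_apply (k : Fin d → ℤ) (i : Fin M)
    (u : lp (fun _ : Fin d → ℤ => EuclideanSpace ℝ (Fin M)) 2) : ciaEval k i u = u k i := rfl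

lemma ciaL_apply (q : Fin d → ℤ) (w : EuclideanSpace ℝ (Fin N)) (k : Fin d → ℤ) (i : Fin M) :
    ciaL H hsum q w k i = ∑ n, H (k - q) i n * w n := by
  rw [← ciaEval_apply]
  simp only [ciaL, LinearMap.coe_mk, AddHom.coe_mk, map_sum, map_smul, ciaEval_apply, ciaV_apply,
    smul_eq_mul, mul_comm]

lemma cia_iso_of_orth
    (ho : ∀ q q' n n', inner ℝ (ciaV H hsum q n) (ciaV H hsum q' n') =
      if q = q' ∧ n = n' then 1 else 0)
    (x : lp (fun _ : Fin d → ℤ => EuclideanSpace ℝ (Fin N)) 2) :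
      ∃ u : lp (fun _ : Fin d → ℤ => EuclideanSpace ℝ (Fin M)) 2,
        (∀ (k : Fin d → ℤ) (i : Fin M),
          u k i = ∑' m : Fin d → ℤ, ∑ n : Fin N, H m i n * x (k - m) n) ∧
        ‖u‖ = ‖x‖ := by
  have hi : ∀ q q' w w', inner ℝ (ciaL H hsum q w) (ciaL H hsum q' w') =
      if q = q' then inner ℝ w w' else 0 := by
    intro q q' w w'
    simp only [ciaL, LinearMap.coe_mk, AddHom.coe_mk, sum_inner, inner_sum, real_inner_smul_left,
      real_inner_smul_right, ho]
    by_cases h : q = q'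
    · simp [h, PiLp.inner_apply, mul_comm]
    · simp [h]
  let V : ∀ q : Fin d → ℤ, EuclideanSpace ℝ (Fin N) →ₗᵢ[ℝ]
      lp (fun _ : Fin d → ℤ => EuclideanSpace ℝ (Fin M)) 2 := fun q =>
    { toLinearMap := ciaL H hsum q
      norm_map' := fun w => by
        rw [@norm_eq_sqrt_real_inner _ _ _ w, @norm_eq_sqrt_real_inner _ _ _ (ciaL H hsum q w),
          hi, if_pos rfl] }
  have hV : OrthogonalFamily ℝ (fun _ : Fin d → ℤ => EuclideanSpace ℝ (Fin N)) V := by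
    intro q q' hq w w'
    exact (hi q q' w w').trans (if_neg hq)
  refine ⟨hV.linearIsometry x, fun k i => ?_, LinearIsometry.norm_map _ _⟩
  have h1 := (hV.hasSum_linearIsometry x).mapL (ciaEval k i)
  rw [← ciaEval_apply, ← h1.tsum_eq, ← (Equiv.subLeft k).tsum_eq]
  refine tsum_congr fun m => ?_
  refine (ciaL_apply H hsum _ _ k i).trans ?_
  simp

lemma cia_orth_of_iso
    (h : ∀ x : lp (fun _ : Fin d → ℤ => EuclideanSpace ℝ (Fin N)) 2,
      ∃ u : lp (fun _ : Fin d → ℤ => EuclideanSpace ℝ (Fin M)) 2,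
        (∀ (k : Fin d → ℤ) (i : Fin M),
          u k i = ∑' m : Fin d → ℤ, ∑ n : Fin N, H m i n * x (k - m) n) ∧
        ‖u‖ = ‖x‖) (q q' : Fin d → ℤ) (n n' : Fin N) :
    inner ℝ (ciaV H hsum q n) (ciaV H hsum q' n') = if q = q' ∧ n = n' then 1 else 0 := by
  classical
  have hs1 : ∀ (k : Fin d → ℤ) (i : Fin M) (q : Fin d → ℤ) (w : EuclideanSpace ℝ (Fin N)),
      HasSum (fun m : Fin d → ℤ => ∑ n : Fin N, H m i n * (lp.single (E := fun _ : Fin d → ℤ =>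
        EuclideanSpace ℝ (Fin N)) 2 q w) (k - m) n) (∑ n, H (k - q) i n * w n) := by
    intro k i q w
    convert hasSum_single (k - q) ?_ using 1
    · simp
    · intro m hm
      have : k - m ≠ q := fun h => hm (by rw [← h]; simp)
      simp [lp.single_apply, Pi.single_eq_of_ne this]
  have key : ∀ q q' w w', ‖ciaL H hsum q w + ciaL H hsum q' w'‖ =
      ‖lp.single (E := fun _ : Fin d → ℤ => EuclideanSpace ℝ (Fin N)) 2 q w +
        lp.single (E := fun _ : Fin d → ℤ => EuclideanSpace ℝ (Fin N)) 2 q' w'‖ := by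
    intro q q' w w'
    obtain ⟨u, hu, hn⟩ := h (lp.single 2 q w + lp.single 2 q' w')
    rw [← hn]
    congr 1
    apply lp.ext
    funext k
    ext i
    rw [hu]
    have := ((hs1 k i q w).add (hs1 k i q' w')).tsum_eq
    simp only [← Finset.sum_add_distrib, ← mul_add] at this
    refine Eq.trans ?_ (Eq.trans this.symm ?_)
    · rw [lp.coeFn_add, Pi.add_apply, PiLp.add_apply, ciaL_apply, ciaL_apply,
        ← Finset.sum_add_distrib]
    · rfl
  have key1 : ∀ q w, ‖ciaL H hsum q w‖ =
      ‖lp.single (E := fun _ : Fin d → ℤ => EuclideanSpace ℝ (Fin N)) 2 q w‖ := by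
    intro q w
    have := key q q w 0
    simpa using this
  have hL : ∀ q n, ciaV H hsum q n = ciaL H hsum q (EuclideanSpace.single n 1) := by
    intro q n
    simp [ciaL]
  have hin : inner ℝ (ciaV H hsum q n) (ciaV H hsum q' n') =
      inner ℝ (lp.single (E := fun _ : Fin d → ℤ => EuclideanSpace ℝ (Fin N)) 2 q
        (EuclideanSpace.single n 1)) (lp.single (E := fun _ : Fin d → ℤ =>
          EuclideanSpace ℝ (Fin N)) 2 q' (EuclideanSpace.single n' (1 : ℝ))) := by
    rw [real_inner_eq_norm_add_mul_self_sub_norm_mul_self_sub_norm_mul_self_div_two,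
      real_inner_eq_norm_add_mul_self_sub_norm_mul_self_sub_norm_mul_self_div_two,
      hL, hL, key, key1, key1]
  rw [hin, lp.inner_single_left]
  by_cases hq : q = q'
  · subst hq
    simp [EuclideanSpace.inner_single_left, Pi.single_apply]
  · simp [hq]

end
end ConvAux

/-- Let `M ≥ N` and let `H : ℤ^d → ℝ^{M×N}` be a matrix-valued filter
with absolutely summable entries, with frequency response
`Ĥ(ω) = ∑_k H[k] e^{−i⟨ω,k⟩} ∈ ℂ^{M×N}`. Then the convolution operator
`T_H : ℓ₂^N(ℤ^d) → ℓ₂^M(ℤ^d)` is an isometry if and only if `Ĥ` is paraunitary, i.e.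
`Ĥ(ω)ᴴ Ĥ(ω) = I_N` for every `ω ∈ ℝ^d`. -/
theorem conv_isometry_iff_paraunitary
    (d N M : ℕ) (hd : 0 < d) (hN : 0 < N) (hM : 0 < M) (hMN : N ≤ M)
    (H : (Fin d → ℤ) → Matrix (Fin M) (Fin N) ℝ)
    (hsum : ∀ (i : Fin M) (n : Fin N), Summable fun k : Fin d → ℤ => |H k i n|)
    (Hhat : (Fin d → ℝ) → Matrix (Fin M) (Fin N) ℂ)
    (Hhat_def : ∀ (ω : Fin d → ℝ) (i : Fin M) (n : Fin N),
      Hhat ω i n = ∑' k : Fin d → ℤ,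
        (H k i n : ℂ) * Complex.exp (-Complex.I * ((∑ j, ω j * (k j : ℝ) : ℝ) : ℂ))) :
    (∀ x : lp (fun _ : Fin d → ℤ => EuclideanSpace ℝ (Fin N)) 2,
      ∃ u : lp (fun _ : Fin d → ℤ => EuclideanSpace ℝ (Fin M)) 2,
        (∀ (k : Fin d → ℤ) (i : Fin M),
          u k i = ∑' m : Fin d → ℤ, ∑ n : Fin N, H m i n * x (k - m) n) ∧
        ‖u‖ = ‖x‖) ↔
    (∀ ω : Fin d → ℝ, (Hhat ω)ᴴ * Hhat ω = (1 : Matrix (Fin N) (Fin N) ℂ)) := by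
  classical
  have hB : ∀ n n', (Summable fun p => ‖((∑ i, ∑' k, H k i n * H (k + p) i n' : ℝ) : ℂ)‖) ∧
      ∀ ω : Fin d → ℝ, HasSum (fun p : Fin d → ℤ =>
        ((∑ i, ∑' k, H k i n * H (k + p) i n' : ℝ) : ℂ) *
        Complex.exp (-Complex.I * ((∑ j, ω j * (p j : ℝ) : ℝ) : ℂ)))
        (((Hhat ω)ᴴ * Hhat ω) n n') := by
    intro n n'
    have hc := fun i => cia_corr _ _ (hsum i n) (hsum i n')
    refine ⟨?_, fun ω => ?_⟩
    · refine Summable.of_nonneg_of_le (fun _ => norm_nonneg _) (fun p => ?_)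
        (summable_sum (s := Finset.univ) fun i _ => (hc i).2.1)
      rw [Complex.ofReal_sum]
      exact norm_sum_le _ _
    · have := hasSum_sum (s := Finset.univ) fun i _ => (hc i).2.2 ω
      simp only [← Hhat_def, ← Finset.sum_mul, ← Complex.ofReal_sum] at this
      rw [Matrix.mul_apply]
      exact this
  constructor
  · intro h ω
    have ho := cia_orth_of_iso H hsum h
    ext n n'
    refine ((hB n n').2 ω).unique ?_
    have hR : ∀ p, (∑ i, ∑' k, H k i n * H (k + p) i n') =
        if p = 0 ∧ n = n' then 1 else 0 := by
      intro p
      have := ho p 0 n n'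
      rwa [ciaV_inner, sub_zero] at this
    simp only [hR]
    convert hasSum_single (0 : Fin d → ℤ) ?_ using 1
    · by_cases hn : n = n' <;> simp [Matrix.one_apply, hn]
    · intro p hp
      simp [hp]
  · intro h
    refine cia_iso_of_orth H hsum fun q q' n n' => ?_
    rw [ciaV_inner]
    have h1 := cia_unique _ (hB n n').1 ((1 : Matrix (Fin N) (Fin N) ℂ) n n')
      (fun ω => by rw [← h ω]; exact (hB n n').2 ω) (q - q')
    apply Complex.ofReal_injective
    rw [h1]
    simp only [Matrix.one_apply, sub_eq_zero]
    by_cases hq : q = q' <;> by_cases hn : n = n' <;> simp [hq, hn]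
end
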